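/- For every quantum covariance matrix V_AB on n_A + n_B modes, the Gaussian Rényi-2 squashed entanglement equals the Gaussian Rényi-2 entanglement of formation: E^G_{sq,2}(A:B)_V = E^G_{F,2}(A:B)_V. -/

import Mathlib

open Matrix
open scoped ComplexOrder

/-- Embedding of the `AB` indices into the `ABC` indices. -/
def eAB {α β γ : Type*} : α ⊕ β → α ⊕ (β ⊕ γ) := Sum.map id Sum.inl

/-- Embedding of the `AC` indices into the `ABC` indices. -/
def eAC {α β γ : Type*} : α ⊕ γ → α ⊕ (β ⊕ γ) := Sum.map id Sum.inr

/-- Embedding of the `BC` indices into the `ABC` indices. -/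
def eBC {α β γ : Type*} : β ⊕ γ → α ⊕ (β ⊕ γ) := Sum.inr

/-- Embedding of the `C` indices into the `ABC` indices. -/
def eC {α β γ : Type*} : γ → α ⊕ (β ⊕ γ) := fun k => Sum.inr (Sum.inr k)

/-- Log-det mutual information of a bipartite positive definite matrix. -/
noncomputable def IM2 {α β : Type*} [Fintype α] [Fintype β] [DecidableEq α] [DecidableEq β]
    (V : Matrix (α ⊕ β) (α ⊕ β) ℝ) : ℝ :=
  (1 / 2) * Real.log ((V.toBlocks₁₁.det * V.toBlocks₂₂.det) / V.det)

/-- Log-det conditional mutual information of a tripartite positive definite matrix. -/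
noncomputable def IM3 {α β γ : Type*} [Fintype α] [Fintype β] [Fintype γ]
    [DecidableEq α] [DecidableEq β] [DecidableEq γ]
    (V : Matrix (α ⊕ (β ⊕ γ)) (α ⊕ (β ⊕ γ)) ℝ) : ℝ :=
  (1 / 2) * Real.log
    (((V.submatrix eAC eAC).det * (V.submatrix eBC eBC).det) /
      ((V.submatrix eC eC).det * V.det))

/-- The standard symplectic form on `n` modes. -/
def Omg (n : ℕ) : Matrix (Fin n ⊕ Fin n) (Fin n ⊕ Fin n) ℝ :=
  fromBlocks 0 1 (-1) 0

/-- A real matrix is symplectic (with respect to a given form `Ω`) if `S Ω Sᵀ = Ω`. -/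
def IsSymplectic {N : Type*} [Fintype N] (Ω S : Matrix N N ℝ) : Prop :=
  S * Ω * Sᵀ = Ω

/-- Complexification of a real matrix. -/
noncomputable def cplx {μ ν : Type*} (M : Matrix μ ν ℝ) : Matrix μ ν ℂ :=
  M.map (fun x => (x : ℂ))

/-- A quantum covariance matrix with respect to a symplectic form `Ω`: a real symmetric
matrix `V` with `V + iΩ ≥ 0`. -/
def IsQCM {N : Type*} [Fintype N] [DecidableEq N] (Ω V : Matrix N N ℝ) : Prop :=
  V.IsSymm ∧ (cplx V + Complex.I • cplx Ω).PosSemidef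

/-- A pure quantum covariance matrix: `V = S Sᵀ` with `S` symplectic. -/
def IsPureQCM {N : Type*} [Fintype N] (Ω V : Matrix N N ℝ) : Prop :=
  ∃ S, IsSymplectic Ω S ∧ V = S * Sᵀ

/-- The Gaussian Rényi-2 entanglement of formation of a bipartite QCM `V`, with respect
to the bipartite symplectic form `Ω`. -/
noncomputable def EF2 {α β : Type*} [Fintype α] [Fintype β] [DecidableEq α] [DecidableEq β]
    (Ω V : Matrix (α ⊕ β) (α ⊕ β) ℝ) : ℝ :=
  sInf {x | ∃ γ : Matrix (α ⊕ β) (α ⊕ β) ℝ,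
    IsPureQCM Ω γ ∧ (V - γ).PosSemidef ∧ x = (1 / 2) * IM2 γ}

/-- The Gaussian Rényi-2 squashed entanglement of a bipartite QCM `V_AB` on
`n_A + n_B` modes: the infimum of `(1/2)·I_M(A:B|C)` over all QCM extensions of
`V_AB` by an arbitrary number `m` of ancillary modes `C`. -/
noncomputable def Esq2 {nA nB : ℕ}
    (V : Matrix ((Fin nA ⊕ Fin nA) ⊕ (Fin nB ⊕ Fin nB))
      ((Fin nA ⊕ Fin nA) ⊕ (Fin nB ⊕ Fin nB)) ℝ) : ℝ :=
  sInf {x | ∃ (m : ℕ)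
    (W : Matrix ((Fin nA ⊕ Fin nA) ⊕ ((Fin nB ⊕ Fin nB) ⊕ (Fin m ⊕ Fin m)))
      ((Fin nA ⊕ Fin nA) ⊕ ((Fin nB ⊕ Fin nB) ⊕ (Fin m ⊕ Fin m))) ℝ),
    IsQCM (fromBlocks (Omg nA) 0 0 (fromBlocks (Omg nB) 0 0 (Omg m))) W ∧
      W.submatrix eAB eAB = V ∧ x = (1 / 2) * IM3 W}

section SInf

/-- Two sets of reals that dominate each other up to an arbitrarily small error have the same
`sInf`, including the degenerate cases. -/
lemma sInf_eq_sInf_of_approx {S T : Set ℝ} (h₁ : ∀ x ∈ S, ∃ y ∈ T, y ≤ x)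
    (h₂ : ∀ y ∈ T, ∀ ε > 0, ∃ x ∈ S, x ≤ y + ε) : sInf S = sInf T := by
  rcases S.eq_empty_or_nonempty with rfl | hS
  · rcases T.eq_empty_or_nonempty with rfl | ⟨y, hy⟩
    · rfl
    · obtain ⟨x, hx, -⟩ := h₂ y hy 1 one_pos
      exact hx.elim
  obtain ⟨x₀, hx₀⟩ := hS
  obtain ⟨y₀, hy₀, -⟩ := h₁ x₀ hx₀
  by_cases hb : BddBelow T
  · have hbS : BddBelow S := by
      obtain ⟨b, hb⟩ := hb
      refine ⟨b, fun x hx => ?_⟩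
      obtain ⟨y, hy, hyx⟩ := h₁ x hx
      exact (hb hy).trans hyx
    apply le_antisymm
    · refine le_csInf ⟨y₀, hy₀⟩ fun y hy => le_of_forall_pos_le_add fun ε hε => ?_
      obtain ⟨x, hx, hxy⟩ := h₂ y hy ε hε
      exact (csInf_le hbS hx).trans hxy
    · refine le_csInf ⟨x₀, hx₀⟩ fun x hx => ?_
      obtain ⟨y, hy, hyx⟩ := h₁ x hx
      exact (csInf_le hb hy).trans hyx
  · have hbS : ¬ BddBelow S := by
      rintro ⟨b, hbS⟩
      refine hb ⟨b - 1, fun y hy => ?_⟩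
      obtain ⟨x, hx, hxy⟩ := h₂ y hy 1 one_pos
      linarith [hbS hx]
    rw [Real.sInf_of_not_bddBelow hb, Real.sInf_of_not_bddBelow hbS]

end SInf

section Det

variable {N : Type*} [Fintype N] [DecidableEq N]

open scoped MatrixOrder

/-- A positive definite real matrix has a positive definite square root. -/
lemma Matrix.PosDef.exists_sqrt {A : Matrix N N ℝ} (hA : A.PosDef) :
    ∃ R : Matrix N N ℝ, R.PosDef ∧ R * R = A := by
  have h := CFC.sqrt_mul_sqrt_self A hA.posSemidef.nonneg
  refine ⟨CFC.sqrt A, ?_, h⟩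
  refine (CFC.sqrt_nonneg A).posSemidef.posDef_iff_det_ne_zero.2 fun h0 => hA.det_pos.ne' ?_
  rw [← h, det_mul, h0, mul_zero]

lemma Matrix.PosSemidef.one_le_det_one_add {Q : Matrix N N ℝ} (hQ : Q.PosSemidef) :
    1 ≤ (1 + Q).det := by
  have hH : (1 + Q).IsHermitian := isHermitian_one.add hQ.1
  rw [hH.det_eq_prod_eigenvalues]
  refine Finset.one_le_prod fun i _ => ?_
  have h := hH.eigenvalues_mem_spectrum_real i
  have hs := (posSemidef_iff_isHermitian_and_spectrum_nonneg.1 hQ).2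
  generalize hH.eigenvalues i = x at h
  rw [← map_one (algebraMap ℝ (Matrix N N ℝ)), ← spectrum.singleton_add_eq] at h
  obtain ⟨_, rfl, y, hy, rfl⟩ := h
  have := hs hy
  simp only [Set.mem_ofPred_eq] at this
  simpa using this

/-- The determinant is monotone on positive definite matrices. -/
lemma Matrix.PosDef.det_le_det {A B : Matrix N N ℝ} (hA : A.PosDef) (h : (B - A).PosSemidef) :
    A.det ≤ B.det := by
  obtain ⟨R, hR, rfl⟩ := hA.exists_sqrt
  have hu : IsUnit R.det := hR.det_pos.ne'.isUnit
  have hQ := h.conjTranspose_mul_mul_same R⁻¹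
  rw [conjTranspose_nonsing_inv, hR.1.eq] at hQ
  have hB : B = R * (1 + R⁻¹ * (B - R * R) * R⁻¹) * R := by
    have h1 : R * (R⁻¹ * (B - R * R) * R⁻¹) * R = (R * R⁻¹) * (B - R * R) * (R⁻¹ * R) := by
      noncomm_ring
    rw [mul_add, add_mul, h1, mul_nonsing_inv _ hu, nonsing_inv_mul _ hu]
    simp
  have := hQ.one_le_det_one_add
  rw [hB]
  simp only [det_mul]
  nlinarith [mul_pos hR.det_pos hR.det_pos]

/-- Jacobi's complementary minor identity for the top left block. -/
lemma det_mul_det_inv_toBlocks₁₁ {M : Type*} [Fintype M] [DecidableEq M]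
    (X : Matrix (N ⊕ M) (N ⊕ M) ℝ) (hX : IsUnit X.det) :
    X.det * X⁻¹.toBlocks₁₁.det = X.toBlocks₂₂.det := by
  have h := mul_nonsing_inv X hX
  obtain ⟨A, B, C, D, hXb⟩ : ∃ A B C D, X = fromBlocks A B C D :=
    ⟨_, _, _, _, (fromBlocks_toBlocks X).symm⟩
  obtain ⟨P, Q, R, S, hYb⟩ : ∃ A B C D, X⁻¹ = fromBlocks A B C D :=
    ⟨_, _, _, _, (fromBlocks_toBlocks X⁻¹).symm⟩
  rw [hYb, hXb, fromBlocks_multiply, ← fromBlocks_one, fromBlocks_inj] at h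
  have h2 : X * fromBlocks P 0 R 1 = fromBlocks 1 B 0 D := by
    rw [hXb, fromBlocks_multiply, h.1, h.2.2.1]; simp
  have h3 := congrArg det h2
  rw [det_mul, det_fromBlocks_zero₁₂, det_fromBlocks_zero₂₁] at h3
  rw [hYb]
  simpa [hXb] using h3

/-- Jacobi's complementary minor identity for the bottom right block. -/
lemma det_mul_det_inv_toBlocks₂₂ {M : Type*} [Fintype M] [DecidableEq M]
    (X : Matrix (N ⊕ M) (N ⊕ M) ℝ) (hX : IsUnit X.det) :
    X.det * X⁻¹.toBlocks₂₂.det = X.toBlocks₁₁.det := by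
  have h := mul_nonsing_inv X hX
  obtain ⟨A, B, C, D, hXb⟩ : ∃ A B C D, X = fromBlocks A B C D :=
    ⟨_, _, _, _, (fromBlocks_toBlocks X).symm⟩
  obtain ⟨P, Q, R, S, hYb⟩ : ∃ A B C D, X⁻¹ = fromBlocks A B C D :=
    ⟨_, _, _, _, (fromBlocks_toBlocks X⁻¹).symm⟩
  rw [hYb, hXb, fromBlocks_multiply, ← fromBlocks_one, fromBlocks_inj] at h
  have h2 : X * fromBlocks 1 Q 0 S = fromBlocks A 0 C 1 := by
    rw [hXb, fromBlocks_multiply, h.2.1, h.2.2.2]; simp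
  have h3 := congrArg det h2
  rw [det_mul, det_fromBlocks_zero₁₂, det_fromBlocks_zero₂₁] at h3
  rw [hYb]
  simpa [hXb] using h3

end Det

section GeometricMean

variable {N : Type*} [Fintype N] [DecidableEq N]

open scoped MatrixOrder

/-- For a positive definite `X`, the geometric mean of `X` and `Ω X⁻¹ Ωᵀ` is a pure quantum
covariance matrix. -/
lemma exists_isPureQCM_geomMean {Ω X : Matrix N N ℝ} (hΩ : Ωᵀ = -Ω) (hΩ2 : Ω * Ω = -1)
    (hX : X.PosDef) :
    ∃ G : Matrix N N ℝ, G.PosDef ∧ G * X⁻¹ * G = Ω * X⁻¹ * Ωᵀ ∧ IsPureQCM Ω G := by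
  obtain ⟨R, hR, hRX⟩ := hX.exists_sqrt
  have hRu : IsUnit R.det := hR.det_pos.ne'.isUnit
  have hRT : Rᵀ = R := by simpa using hR.1.eq
  have hR1 : R * R⁻¹ = 1 := mul_nonsing_inv _ hRu
  have hR2 : R⁻¹ * R = 1 := nonsing_inv_mul _ hRu
  have hRiT : (R⁻¹)ᵀ = R⁻¹ := by rw [transpose_nonsing_inv, hRT]
  have hΩu : IsUnit Ω.det := by
    refine IsUnit.of_mul_eq_one (-Ω).det ?_
    rw [← det_mul, mul_neg, hΩ2, neg_neg, det_one]
  set Z := R⁻¹ * Ω * R⁻¹ with hZ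
  have hZT : Zᵀ = -Z := by
    simp only [hZ, transpose_mul, hRiT, hΩ]; noncomm_ring
  have hZu : IsUnit Z.det := by
    have := (isUnit_nonsing_inv_det_iff.2 hRu)
    simp only [hZ, det_mul]
    exact (this.mul hΩu).mul this
  have hZZ : (Zᵀ * Z).PosDef := by
    have := posSemidef_conjTranspose_mul_self Z
    refine (this.posDef_iff_det_ne_zero.2 ?_)
    simpa using hZu.ne_zero
  set T := CFC.sqrt (Zᵀ * Z) with hT
  have hTT : T * T = Zᵀ * Z := CFC.sqrt_mul_sqrt_self _ hZZ.posSemidef.nonneg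
  have hTps : T.PosSemidef := (CFC.sqrt_nonneg _).posSemidef
  have hTdet : T.det ≠ 0 := by
    intro h0
    apply hZZ.det_pos.ne'
    rw [← hTT, det_mul, h0, mul_zero]
  have hTpd : T.PosDef := hTps.posDef_iff_det_ne_zero.2 hTdet
  have hTu : IsUnit T.det := hTdet.isUnit
  have hcomm : Commute T Z := by
    have h1 : Commute (Zᵀ * Z) Z := by
      rw [hZT, commute_iff_eq]; noncomm_ring
    rw [hT, CFC.sqrt_eq_cfc]
    exact h1.cfc_nnreal _
  have hRZR : R * Z * R = Ω := by
    have : R * Z * R = (R * R⁻¹) * Ω * (R⁻¹ * R) := by rw [hZ]; noncomm_ring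
    rw [this, hR1, hR2, one_mul, mul_one]
  set G := R * T * R with hG
  have hGpd : G.PosDef := by
    have := (hR.isUnit.posDef_star_left_conjugate_iff (x := T)).2 hTpd
    rwa [star_eq_conjTranspose, hR.1.eq] at this
  have hXi : X⁻¹ = R⁻¹ * R⁻¹ := by rw [← hRX, Matrix.mul_inv_rev]
  have hGXG : G * X⁻¹ * G = Ω * X⁻¹ * Ωᵀ := by
    have h1 : G * X⁻¹ * G = R * T * (R * R⁻¹) * (R⁻¹ * R) * T * R := by
      rw [hG, hXi]; noncomm_ring
    have h2 : Ω * X⁻¹ * Ωᵀ = -(R * Z * (R * R⁻¹) * (R⁻¹ * R) * Z * R) := by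
      rw [hXi, hΩ, ← hRZR]; noncomm_ring
    rw [h1, h2, hR1, hR2]
    simp only [mul_one]
    rw [mul_assoc R T T, hTT, hZT]
    noncomm_ring
  have hsymp : G * Ω * G = Ω := by
    have hZ1 : Z * Z⁻¹ = 1 := mul_nonsing_inv _ hZu
    have hZ2 : Z⁻¹ * Z = 1 := nonsing_inv_mul _ hZu
    have hZ3 : Z * R * Ω * R = -1 := by
      have h1 : Z * R * Ω * R = R⁻¹ * (R * Z * R * Ω) * R := by
        rw [show R⁻¹ * (R * Z * R * Ω) * R = (R⁻¹ * R) * (Z * R * Ω * R) by noncomm_ring, hR2,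
          one_mul]
      rw [h1, hRZR, hΩ2, mul_neg, mul_one, neg_mul, hR2]
    have hROR : R * Ω * R = -Z⁻¹ := by
      have h1 : R * Ω * R = Z⁻¹ * (Z * R * Ω * R) := by
        rw [show Z⁻¹ * (Z * R * Ω * R) = (Z⁻¹ * Z) * (R * Ω * R) by noncomm_ring, hZ2, one_mul]
      rw [h1, hZ3, mul_neg, mul_one]
    have hTZT : T * Z⁻¹ * T = -Z := by
      have h1 : T * Z⁻¹ = Z⁻¹ * T := by
        calc T * Z⁻¹ = Z⁻¹ * (Z * T) * Z⁻¹ := by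
              rw [← mul_assoc Z⁻¹ Z T, hZ2, one_mul]
          _ = Z⁻¹ * (T * Z) * Z⁻¹ := by rw [hcomm.eq]
          _ = Z⁻¹ * T * (Z * Z⁻¹) := by noncomm_ring
          _ = Z⁻¹ * T := by rw [hZ1, mul_one]
      rw [h1, mul_assoc, hTT, hZT, neg_mul, mul_neg, ← mul_assoc, hZ2, one_mul]
    calc G * Ω * G = R * T * (R * Ω * R) * T * R := by rw [hG]; noncomm_ring
      _ = -(R * (T * Z⁻¹ * T) * R) := by rw [hROR]; noncomm_ring
      _ = Ω := by rw [hTZT, ← hRZR]; noncomm_ring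
  refine ⟨G, hGpd, hGXG, ?_⟩
  obtain ⟨H, hH, hHG⟩ := hGpd.exists_sqrt
  have hHu : IsUnit H.det := hH.det_pos.ne'.isUnit
  have hHT : Hᵀ = H := by simpa using hH.1.eq
  have hH1 : H * H⁻¹ = 1 := mul_nonsing_inv _ hHu
  have hH2 : H⁻¹ * H = 1 := nonsing_inv_mul _ hHu
  have hΩΩ : Ω * Ωᵀ = 1 := by rw [hΩ, mul_neg, hΩ2, neg_neg]
  have hΩΩ' : Ωᵀ * Ω = 1 := by rw [hΩ, neg_mul, hΩ2, neg_neg]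
  have hH'ps : (Ωᵀ * H⁻¹ * Ω).PosSemidef := by
    simpa using hH.inv.posSemidef.conjTranspose_mul_mul_same Ω
  have hH'2 : (Ωᵀ * H⁻¹ * Ω) * (Ωᵀ * H⁻¹ * Ω) = G := by
    have hGi : G⁻¹ = H⁻¹ * H⁻¹ := by rw [← hHG, Matrix.mul_inv_rev]
    have hGu : IsUnit G.det := hGpd.det_pos.ne'.isUnit
    calc (Ωᵀ * H⁻¹ * Ω) * (Ωᵀ * H⁻¹ * Ω) = Ωᵀ * H⁻¹ * (Ω * Ωᵀ) * H⁻¹ * Ω := by noncomm_ring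
      _ = Ωᵀ * G⁻¹ * Ω := by rw [hΩΩ, hGi]; noncomm_ring
      _ = Ωᵀ * G⁻¹ * (G * Ω * G) := by rw [hsymp]
      _ = Ωᵀ * (G⁻¹ * G) * Ω * G := by noncomm_ring
      _ = G := by rw [nonsing_inv_mul _ hGu, mul_one, hΩΩ', one_mul]
  have hHH' : H = Ωᵀ * H⁻¹ * Ω := by
    exact (CFC.sqrt_unique hHG hH.posSemidef.nonneg).symm.trans
      (CFC.sqrt_unique hH'2 hH'ps.nonneg)
  refine ⟨H, ?_, by rw [hHT, hHG]⟩
  calc H * Ω * Hᵀ = H * Ω * (Ωᵀ * H⁻¹ * Ω) := by rw [hHT, ← hHH']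
    _ = H * (Ω * Ωᵀ) * H⁻¹ * Ω := by noncomm_ring
    _ = Ω := by rw [hΩΩ, mul_one, hH1, one_mul]

/-- A geometric mean lies below every common upper bound. -/
lemma posSemidef_sub_of_geomMean {X Y G P : Matrix N N ℝ} (hX : X.PosDef) (hG : G.IsHermitian)
    (hY : G * X⁻¹ * G = Y) (hXP : (P - X).PosSemidef) (hYP : (P - Y).PosSemidef) :
    (P - G).PosSemidef := by
  have hu : IsUnit X.det := hX.det_pos.ne'.isUnit
  have h1 : ((X - G) * X⁻¹ * (X - G)).PosSemidef := by
    have := hX.inv.posSemidef.conjTranspose_mul_mul_same (X - G)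
    rwa [(hX.1.sub hG).eq] at this
  have h2 : (X - G) * X⁻¹ * (X - G) = X - G - G + Y := by
    rw [← hY]
    calc (X - G) * X⁻¹ * (X - G)
        = X * X⁻¹ * X - X * X⁻¹ * G - G * (X⁻¹ * X) + G * X⁻¹ * G := by noncomm_ring
      _ = _ := by rw [mul_nonsing_inv _ hu, nonsing_inv_mul _ hu, one_mul, one_mul, mul_one]
  rw [h2] at h1
  have h3 := ((hXP.add hYP).add h1).smul (show (0 : ℝ) ≤ 1 / 2 by norm_num)
  convert h3 using 1
  module

/-- Principal minors of a geometric mean are bounded by those of its two arguments. -/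
lemma det_submatrix_geomMean_sq_le {M : Type*} [Fintype M] [DecidableEq M] {X Y G : Matrix N N ℝ}
    (hX : X.PosDef) (hG : G.PosDef) (hY : G * X⁻¹ * G = Y) {f : M → N}
    (hf : Function.Injective f) :
    (G.submatrix f f).det ^ 2 ≤ (X.submatrix f f).det * (Y.submatrix f f).det := by
  have hblock : (fromBlocks X G Gᴴ Y).PosSemidef := by
    have := hX.isUnit.invertible
    rw [PosDef.fromBlocks₁₁ _ _ hX, hG.1.eq, hY, sub_self]
    exact .zero
  have hsub := hblock.submatrix (Sum.map f f)
  have heq : (fromBlocks X G Gᴴ Y).submatrix (Sum.map f f) (Sum.map f f) =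
      fromBlocks (X.submatrix f f) (G.submatrix f f) (G.submatrix f f)ᴴ (Y.submatrix f f) := by
    ext (i | i) (j | j) <;> rfl
  have hXf := hX.submatrix hf
  have hGf := hG.submatrix hf
  have := hXf.isUnit.invertible
  rw [heq, PosDef.fromBlocks₁₁ _ _ hXf] at hsub
  have hpd : ((G.submatrix f f)ᴴ * (X.submatrix f f)⁻¹ * G.submatrix f f).PosDef :=
    (hGf.isUnit.posDef_star_left_conjugate_iff).2 hXf.inv
  have hle := hpd.det_le_det hsub
  rw [hGf.1.eq, det_mul, det_mul, det_nonsing_inv, Ring.inverse_eq_inv'] at hle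
  have hpos := hXf.det_pos
  calc (G.submatrix f f).det ^ 2 = (X.submatrix f f).det * ((G.submatrix f f).det *
        (X.submatrix f f).det⁻¹ * (G.submatrix f f).det) := by field_simp
    _ ≤ _ := by gcongr

/-- The geometric mean of `X` and `Ω X⁻¹ Ωᵀ` has at most the log-det mutual information of `X`. -/
lemma IM2_geomMean_le {α β : Type*} [Fintype α] [Fintype β] [DecidableEq α] [DecidableEq β]
    {ΩA : Matrix α α ℝ} {ΩB : Matrix β β ℝ} (hA : ΩA * ΩAᵀ = 1) (hB : ΩB * ΩBᵀ = 1)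
    {X G : Matrix (α ⊕ β) (α ⊕ β) ℝ} (hX : X.PosDef) (hG : G.PosDef)
    (hGX : G * X⁻¹ * G = fromBlocks ΩA 0 0 ΩB * X⁻¹ * (fromBlocks ΩA 0 0 ΩB)ᵀ) :
    IM2 G ≤ IM2 X := by
  set Y := fromBlocks ΩA 0 0 ΩB * X⁻¹ * (fromBlocks ΩA 0 0 ΩB)ᵀ with hY
  have hXu : IsUnit X.det := hX.det_pos.ne'.isUnit
  have hYA : Y.submatrix Sum.inl Sum.inl = ΩA * X⁻¹.toBlocks₁₁ * ΩAᵀ := by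
    change Y.toBlocks₁₁ = _
    rw [hY]
    conv_lhs => rw [← fromBlocks_toBlocks X⁻¹]
    simp [fromBlocks_transpose, fromBlocks_multiply]
  have hYB : Y.submatrix Sum.inr Sum.inr = ΩB * X⁻¹.toBlocks₂₂ * ΩBᵀ := by
    change Y.toBlocks₂₂ = _
    rw [hY]
    conv_lhs => rw [← fromBlocks_toBlocks X⁻¹]
    simp [fromBlocks_transpose, fromBlocks_multiply]
  have hdA : ΩA.det * ΩA.det = 1 := by
    simpa using congrArg det hA
  have hdB : ΩB.det * ΩB.det = 1 := by
    simpa using congrArg det hB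
  have ha := det_submatrix_geomMean_sq_le hX hG hGX Sum.inl_injective
  have hb := det_submatrix_geomMean_sq_le hX hG hGX Sum.inr_injective
  have jA := det_mul_det_inv_toBlocks₁₁ X hXu
  have jB := det_mul_det_inv_toBlocks₂₂ X hXu
  have hg := congrArg det hGX
  rw [hYA, det_mul, det_mul, det_transpose] at ha
  rw [hYB, det_mul, det_mul, det_transpose] at hb
  rw [hY] at hg
  simp only [det_mul, det_transpose, det_fromBlocks_zero₂₁, det_nonsing_inv,
    Ring.inverse_eq_inv'] at hg
  have hx := hX.det_pos
  have hgp := hG.det_pos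
  have hGA : 0 < G.toBlocks₁₁.det := (hG.submatrix Sum.inl_injective).det_pos
  have hGB : 0 < G.toBlocks₂₂.det := (hG.submatrix Sum.inr_injective).det_pos
  have hXA : 0 < X.toBlocks₁₁.det := (hX.submatrix Sum.inl_injective).det_pos
  have hXB : 0 < X.toBlocks₂₂.det := (hX.submatrix Sum.inr_injective).det_pos
  change G.toBlocks₁₁.det ^ 2 ≤ X.toBlocks₁₁.det * _ at ha
  change G.toBlocks₂₂.det ^ 2 ≤ X.toBlocks₂₂.det * _ at hb
  unfold IM2
  generalize G.toBlocks₁₁.det = gA, G.toBlocks₂₂.det = gB, X⁻¹.toBlocks₁₁.det = iA,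
    X⁻¹.toBlocks₂₂.det = iB, ΩA.det = oA, ΩB.det = oB at *
  have hsq : G.det * G.det = 1 := by
    field_simp at hg
    nlinarith
  have hg1 : G.det = 1 := by nlinarith
  have hXinv : 0 < X.det⁻¹ := inv_pos.2 hx
  have hiA : iA = X.toBlocks₂₂.det / X.det := by rw [← jA]; field_simp
  have hiB : iB = X.toBlocks₁₁.det / X.det := by rw [← jB]; field_simp
  generalize X.toBlocks₁₁.det = xA, X.toBlocks₂₂.det = xB, X.det = x at *
  have hle : gA * gB ≤ xA * xB / x := by
    have ha' : gA ^ 2 ≤ xA * xB / x := by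
      calc gA ^ 2 ≤ _ := ha
        _ = (oA * oA) * (xA * xB / x) := by rw [hiA]; ring
        _ = _ := by rw [hdA, one_mul]
    have hb' : gB ^ 2 ≤ xA * xB / x := by
      calc gB ^ 2 ≤ _ := hb
        _ = (oB * oB) * (xA * xB / x) := by rw [hiB]; ring
        _ = _ := by rw [hdB, one_mul]
    nlinarith [sq_nonneg (gA - gB)]
  rw [hg1, div_one]
  gcongr

end GeometricMean

section QCM

variable {N : Type*} [Fintype N] [DecidableEq N]

lemma IsQCM.quadratic_form_nonneg {Ω V : Matrix N N ℝ} (hV : IsQCM Ω V) (x y : N → ℝ) :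
    0 ≤ x ⬝ᵥ V *ᵥ x + y ⬝ᵥ V *ᵥ y - x ⬝ᵥ Ω *ᵥ y + y ⬝ᵥ Ω *ᵥ x := by
  have h := hV.2.dotProduct_mulVec_nonneg (fun i => (x i : ℂ) + Complex.I * y i)
  have h' := (Complex.le_def.1 h).1
  have key : ∀ (M : Matrix N N ℝ) (u v : N → ℝ),
      (∑ i, ∑ j, u i * (M i j * v j)) = u ⬝ᵥ M *ᵥ v := by
    intro M u v
    simp [dotProduct, mulVec, Finset.mul_sum]
  simp only [dotProduct, mulVec, Complex.zero_re, Complex.re_sum, Finset.mul_sum, cplx] at h' ⊢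
  simp only [← Finset.sum_add_distrib, ← Finset.sum_sub_distrib]
  refine h'.trans (Finset.sum_le_sum fun i _ => Finset.sum_le_sum fun j _ => ?_)
  simp
  nlinarith

lemma IsQCM.posDef {Ω V : Matrix N N ℝ} (hV : IsQCM Ω V) (hΩ : Ωᵀ = -Ω) (hΩ2 : Ω * Ω = -1) :
    V.PosDef := by
  have hH : V.IsHermitian := by simpa [IsHermitian] using hV.1.eq
  have hps : V.PosSemidef := by
    refine .of_dotProduct_mulVec_nonneg hH fun x => ?_
    simpa using hV.quadratic_form_nonneg x 0
  have hsk : ∀ x y : N → ℝ, y ⬝ᵥ Ω *ᵥ x = -(x ⬝ᵥ Ω *ᵥ y) := by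
    intro x y
    rw [dotProduct_mulVec, ← mulVec_transpose, hΩ, neg_mulVec, neg_dotProduct, dotProduct_comm]
  refine .of_dotProduct_mulVec_pos hH fun x hx => ?_
  refine lt_of_le_of_ne (hps.dotProduct_mulVec_nonneg x) fun h0 => hx ?_
  have h0' : x ⬝ᵥ V *ᵥ x = 0 := by simpa using h0.symm
  set w := Ωᵀ *ᵥ x
  have hw : ∀ t : ℝ, 0 ≤ t ^ 2 * (w ⬝ᵥ V *ᵥ w) - 2 * t * (w ⬝ᵥ w) := by
    intro t
    have h := hV.quadratic_form_nonneg x (t • w)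
    rw [h0', hsk x (t • w)] at h
    have h2 : x ⬝ᵥ Ω *ᵥ (t • w) = t * (w ⬝ᵥ w) := by
      rw [mulVec_smul, dotProduct_smul, dotProduct_mulVec, ← mulVec_transpose, smul_eq_mul]
    rw [h2] at h
    simp only [mulVec_smul, dotProduct_smul, smul_dotProduct, smul_eq_mul] at h
    nlinarith
  have hww : w ⬝ᵥ w = 0 := by
    have hnn : 0 ≤ w ⬝ᵥ V *ᵥ w := by simpa using hps.dotProduct_mulVec_nonneg w
    have hww0 : 0 ≤ w ⬝ᵥ w := by simpa using dotProduct_star_self_nonneg w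
    by_contra hne
    have hp : 0 < w ⬝ᵥ w := lt_of_le_of_ne hww0 (Ne.symm hne)
    have h := hw ((w ⬝ᵥ w) / (w ⬝ᵥ V *ᵥ w + 1))
    have h1 : 0 < w ⬝ᵥ V *ᵥ w + 1 := by linarith
    generalize w ⬝ᵥ w = a, w ⬝ᵥ V *ᵥ w = b at *
    field_simp at h
    nlinarith [mul_pos hp hp, mul_nonneg (mul_pos hp hp).le hnn]
  have hw0 : w = 0 := by simpa using hww
  have : Ω *ᵥ (Ωᵀ *ᵥ x) = x := by
    rw [mulVec_mulVec, hΩ, mul_neg, hΩ2, neg_neg, one_mulVec]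
  rw [← this]
  change Ω *ᵥ w = 0
  rw [hw0, mulVec_zero]

lemma IsQCM.two_mul_dotProduct_le {Ω V : Matrix N N ℝ} (hV : IsQCM Ω V) (hΩ : Ωᵀ = -Ω)
    (x y : N → ℝ) : 2 * (x ⬝ᵥ Ω *ᵥ y) ≤ x ⬝ᵥ V *ᵥ x + y ⬝ᵥ V *ᵥ y := by
  have h := hV.quadratic_form_nonneg x y
  have hsk : y ⬝ᵥ Ω *ᵥ x = -(x ⬝ᵥ Ω *ᵥ y) := by
    rw [dotProduct_mulVec, ← mulVec_transpose, hΩ, neg_mulVec, neg_dotProduct, dotProduct_comm]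
  linarith

lemma cplx_mul {l m n : Type*} [Fintype m] (A : Matrix l m ℝ) (B : Matrix m n ℝ) :
    cplx (A * B) = cplx A * cplx B :=
  Matrix.map_mul (f := Complex.ofRealHom)

lemma cplx_conjTranspose {m n : Type*} (A : Matrix m n ℝ) : (cplx A)ᴴ = cplx Aᵀ := by
  ext i j
  simp [cplx]

lemma cplx_add {m n : Type*} (A B : Matrix m n ℝ) : cplx (A + B) = cplx A + cplx B := by
  ext i j
  simp [cplx]

lemma cplx_neg {m n : Type*} (A : Matrix m n ℝ) : cplx (-A) = -cplx A := by
  ext i j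
  simp [cplx]

lemma cplx_one {n : Type*} [DecidableEq n] : cplx (1 : Matrix n n ℝ) = 1 :=
  Matrix.map_one _ Complex.ofReal_zero Complex.ofReal_one

/-- The complexification of a positive semidefinite real matrix is positive semidefinite. -/
lemma Matrix.PosSemidef.cplx {A : Matrix N N ℝ} (hA : A.PosSemidef) :
    (cplx A).PosSemidef := by
  obtain ⟨B, rfl⟩ : ∃ B : Matrix N N ℝ, A = Bᴴ * B := by
    open scoped MatrixOrder in
    exact CStarAlgebra.nonneg_iff_eq_star_mul_self.mp hA.nonneg
  rw [conjTranspose_eq_transpose_of_trivial, cplx_mul, ← cplx_conjTranspose]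
  exact posSemidef_conjTranspose_mul_self _

lemma IsPureQCM.isQCM {Ω V : Matrix N N ℝ} (hV : IsPureQCM Ω V) (hΩ : Ωᵀ = -Ω)
    (hΩ2 : Ω * Ω = -1) : IsQCM Ω V := by
  obtain ⟨S, hS, rfl⟩ := hV
  refine ⟨isSymm_mul_transpose_self S, ?_⟩
  set J := cplx Ω with hJ
  have hJ2 : J * J = -1 := by rw [hJ, ← cplx_mul, hΩ2, cplx_neg, cplx_one]
  have hJH : Jᴴ = -J := by rw [hJ, cplx_conjTranspose, hΩ, cplx_neg]
  have h1 : (1 + Complex.I • J : Matrix N N ℂ).PosSemidef := by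
    have h := (posSemidef_self_mul_conjTranspose (1 + Complex.I • J)).smul
      (show (0 : ℝ) ≤ 1 / 2 by norm_num)
    convert h using 1
    rw [conjTranspose_add, conjTranspose_one, conjTranspose_smul, hJH]
    simp only [RCLike.star_def, Complex.conj_I, smul_neg, neg_smul, neg_neg]
    rw [add_mul, mul_add, mul_add, smul_mul_smul_comm, hJ2, Complex.I_mul_I]
    simp only [one_mul, mul_one, smul_neg, neg_smul, one_smul, neg_neg]
    module
  have h2 := h1.mul_mul_conjTranspose_same (cplx S)
  have h3 : cplx S * J * (cplx S)ᴴ = J := by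
    rw [cplx_conjTranspose, hJ, ← cplx_mul, ← cplx_mul, hS]
  convert h2 using 1
  rw [mul_add, add_mul, Matrix.mul_smul, Matrix.smul_mul, h3, mul_one, cplx_mul, cplx_conjTranspose]

lemma IsPureQCM.posDef {Ω V : Matrix N N ℝ} (hV : IsPureQCM Ω V) (hΩ : Ωᵀ = -Ω)
    (hΩ2 : Ω * Ω = -1) : V.PosDef :=
  (hV.isQCM hΩ hΩ2).posDef hΩ hΩ2

lemma IsQCM.add_posSemidef {Ω V K : Matrix N N ℝ} (hV : IsQCM Ω V) (hK : K.PosSemidef) :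
    IsQCM Ω (V + K) := by
  refine ⟨hV.1.add (by simpa [IsSymm] using hK.1.eq), ?_⟩
  rw [cplx_add, add_right_comm]
  exact hV.2.add hK.cplx

lemma IsQCM.submatrix {M : Type*} [Fintype M] [DecidableEq M] {Ω V : Matrix N N ℝ}
    (hV : IsQCM Ω V) (e : M → N) : IsQCM (Ω.submatrix e e) (V.submatrix e e) :=
  ⟨hV.1.submatrix e, hV.2.submatrix e⟩

lemma isPureQCM_one {Ω : Matrix N N ℝ} : IsPureQCM Ω (1 : Matrix N N ℝ) :=
  ⟨1, by simp [IsSymplectic], by simp⟩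

lemma IsPureQCM.fromBlocks {L M : Type*} [Fintype L] [Fintype M] {Ω V : Matrix L L ℝ}
    {Ω' V' : Matrix M M ℝ} (hV : IsPureQCM Ω V) (hV' : IsPureQCM Ω' V') :
    IsPureQCM (fromBlocks Ω 0 0 Ω') (fromBlocks V 0 0 V') := by
  obtain ⟨S, hS, rfl⟩ := hV
  obtain ⟨S', hS', rfl⟩ := hV'
  unfold IsSymplectic at hS hS'
  refine ⟨.fromBlocks S 0 0 S', ?_, ?_⟩
  · simp [IsSymplectic, fromBlocks_transpose, fromBlocks_multiply, hS, hS']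
  · simp [fromBlocks_transpose, fromBlocks_multiply]

end QCM

section Schur

variable {α β γ : Type*} [Fintype α] [Fintype β] [Fintype γ]
  [DecidableEq α] [DecidableEq β] [DecidableEq γ]

/-- The conditional log-det mutual information is the mutual information of the Schur
complement. -/
lemma IM3_submatrix_sumAssoc_symm (P : Matrix (α ⊕ β) (α ⊕ β) ℝ) (Q : Matrix (α ⊕ β) γ ℝ)
    (R : Matrix γ γ ℝ) (hR : IsUnit R.det) :
    IM3 ((fromBlocks P Q Qᵀ R).submatrix (Equiv.sumAssoc α β γ).symm (Equiv.sumAssoc α β γ).symm) =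
      IM2 (P - Q * R⁻¹ * Qᵀ) := by
  have := invertibleOfIsUnitDet R hR
  set U := (fromBlocks P Q Qᵀ R).submatrix (Equiv.sumAssoc α β γ).symm
    (Equiv.sumAssoc α β γ).symm with hU
  set X := P - Q * R⁻¹ * Qᵀ with hX
  have hAC : U.submatrix eAC eAC = fromBlocks P.toBlocks₁₁ (Q.submatrix Sum.inl id)
      (Q.submatrix Sum.inl id)ᵀ R := by
    ext (i | i) (j | j) <;> rfl
  have hBC : U.submatrix eBC eBC = fromBlocks P.toBlocks₂₂ (Q.submatrix Sum.inr id)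
      (Q.submatrix Sum.inr id)ᵀ R := by
    ext (i | i) (j | j) <;> rfl
  have hC : U.submatrix eC eC = R := by
    ext i j; rfl
  have dAC : (U.submatrix eAC eAC).det = R.det * X.toBlocks₁₁.det := by
    rw [hAC, det_fromBlocks₂₂, invOf_eq_nonsing_inv]
    rfl
  have dBC : (U.submatrix eBC eBC).det = R.det * X.toBlocks₂₂.det := by
    rw [hBC, det_fromBlocks₂₂, invOf_eq_nonsing_inv]
    rfl
  have dU : U.det = R.det * X.det := by
    rw [hU, det_submatrix_equiv_self, det_fromBlocks₂₂, invOf_eq_nonsing_inv]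
  unfold IM3 IM2
  rw [dAC, dBC, hC, dU]
  congr 2
  have hR0 := hR.ne_zero
  rw [show R.det * X.toBlocks₁₁.det * (R.det * X.toBlocks₂₂.det) =
    (R.det * R.det) * (X.toBlocks₁₁.det * X.toBlocks₂₂.det) by ring,
    ← mul_assoc R.det R.det X.det,
    mul_div_mul_left _ _ (mul_ne_zero hR0 hR0)]

lemma fromBlocks_quadratic_form {μ : Type*} [Fintype μ] (P : Matrix μ μ ℝ) (Q : Matrix μ γ ℝ)
    (R : Matrix γ γ ℝ) (hR : R.PosDef) (b : μ → ℝ) :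
    Sum.elim b (-(R⁻¹ *ᵥ (Qᵀ *ᵥ b))) ⬝ᵥ
      fromBlocks P Q Qᵀ R *ᵥ Sum.elim b (-(R⁻¹ *ᵥ (Qᵀ *ᵥ b))) =
      b ⬝ᵥ (P - Q * R⁻¹ * Qᵀ) *ᵥ b := by
  rw [fromBlocks_mulVec]
  simp only [Sum.elim_comp_inl, Sum.elim_comp_inr]
  rw [dotProduct, Fintype.sum_sum_type]
  simp only [Sum.elim_inl, Sum.elim_inr]
  change b ⬝ᵥ (P *ᵥ b + Q *ᵥ -(R⁻¹ *ᵥ (Qᵀ *ᵥ b))) +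
    (-(R⁻¹ *ᵥ (Qᵀ *ᵥ b))) ⬝ᵥ (Qᵀ *ᵥ b + R *ᵥ -(R⁻¹ *ᵥ (Qᵀ *ᵥ b))) = _
  have hz : R *ᵥ -(R⁻¹ *ᵥ (Qᵀ *ᵥ b)) = -(Qᵀ *ᵥ b) := by
    rw [mulVec_neg, mulVec_mulVec _ R, mul_nonsing_inv _ hR.det_pos.ne'.isUnit, one_mulVec]
  rw [hz, add_neg_cancel, dotProduct_zero, add_zero, mulVec_neg, mulVec_mulVec, mulVec_mulVec,
    ← sub_eq_add_neg, ← sub_mulVec]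

/-- The Schur complement `X` of a QCM with respect to the conditioning system satisfies
`Ω X⁻¹ Ωᵀ ≤ P`, where `P` is the reduced QCM. -/
lemma IsQCM.posSemidef_sub_schur {Ω P : Matrix α α ℝ} {Q : Matrix α γ ℝ} {Ω' R : Matrix γ γ ℝ}
    (hU : IsQCM (fromBlocks Ω 0 0 Ω') (fromBlocks P Q Qᵀ R)) (hΩ : Ωᵀ = -Ω) (hΩ' : Ω'ᵀ = -Ω')
    (hP : P.IsHermitian) (hR : R.PosDef) (hX : (P - Q * R⁻¹ * Qᵀ).PosDef) :
    (P - Ω * (P - Q * R⁻¹ * Qᵀ)⁻¹ * Ωᵀ).PosSemidef := by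
  set X := P - Q * R⁻¹ * Qᵀ with hXdef
  have hY : (Ω * X⁻¹ * Ωᵀ).IsHermitian := by
    simpa using (hX.inv.posSemidef.mul_mul_conjTranspose_same Ω).1
  refine .of_dotProduct_mulVec_nonneg (hP.sub hY) fun a => ?_
  set b := X⁻¹ *ᵥ (Ωᵀ *ᵥ a) with hb
  have hskew : (fromBlocks Ω 0 0 Ω')ᵀ = -fromBlocks Ω 0 0 Ω' := by
    simp [fromBlocks_transpose, fromBlocks_neg, hΩ, hΩ']
  have h := hU.two_mul_dotProduct_le hskew (Sum.elim a 0) (Sum.elim b (-(R⁻¹ *ᵥ (Qᵀ *ᵥ b))))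
  rw [fromBlocks_quadratic_form P Q R hR b, ← hXdef, fromBlocks_mulVec, fromBlocks_mulVec] at h
  simp only [Sum.elim_comp_inl, Sum.elim_comp_inr, sumElim_dotProduct_sumElim, zero_mulVec,
    add_zero, mulVec_zero, zero_dotProduct] at h
  have hXb : X *ᵥ b = Ωᵀ *ᵥ a := by
    rw [hb, mulVec_mulVec, mul_nonsing_inv _ hX.det_pos.ne'.isUnit, one_mulVec]
  have hbX : b ⬝ᵥ X *ᵥ b = a ⬝ᵥ Ω *ᵥ b := by
    rw [hXb, dotProduct_comm, mulVec_transpose, ← dotProduct_mulVec]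
  have hYa : (Ω * X⁻¹ * Ωᵀ) *ᵥ a = Ω *ᵥ b := by
    rw [hb, mulVec_mulVec, mulVec_mulVec, mul_assoc]
  rw [hbX] at h
  simp only [star_trivial, sub_mulVec, dotProduct_sub, hYa]
  linarith

end Schur

section Omg

lemma Omg_transpose (n : ℕ) : (Omg n)ᵀ = -Omg n := by
  simp [Omg, fromBlocks_transpose, fromBlocks_neg]

lemma Omg_mul_self (n : ℕ) : Omg n * Omg n = -1 := by
  simp [Omg, fromBlocks_multiply, ← fromBlocks_one, fromBlocks_neg]

lemma fromBlocks_diag_transpose {α β : Type*} {A : Matrix α α ℝ} {B : Matrix β β ℝ}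
    (hA : Aᵀ = -A) (hB : Bᵀ = -B) : (fromBlocks A 0 0 B)ᵀ = -fromBlocks A 0 0 B := by
  simp [fromBlocks_transpose, fromBlocks_neg, hA, hB]

lemma fromBlocks_diag_mul_self {α β : Type*} [Fintype α] [Fintype β] [DecidableEq α]
    [DecidableEq β] {A : Matrix α α ℝ} {B : Matrix β β ℝ} (hA : A * A = -1) (hB : B * B = -1) :
    fromBlocks A 0 0 B * fromBlocks A 0 0 B = -1 := by
  simp [fromBlocks_multiply, ← fromBlocks_one, fromBlocks_neg, hA, hB]

lemma fromBlocks_sumAssoc {α β γ : Type*} (A : Matrix α α ℝ) (B : Matrix β β ℝ)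
    (C : Matrix γ γ ℝ) :
    (fromBlocks A 0 0 (fromBlocks B 0 0 C)).submatrix (Equiv.sumAssoc α β γ)
      (Equiv.sumAssoc α β γ) = fromBlocks (fromBlocks A 0 0 B) 0 0 C := by
  ext ((i | i) | i) ((j | j) | j) <;> rfl

end Omg

section Main

variable {nA nB : ℕ}

/-- Every extension of `V` dominates a pure QCM below `V` in terms of mutual information. -/
lemma exists_isPureQCM_IM2_le_IM3 {m : ℕ}
    {W : Matrix ((Fin nA ⊕ Fin nA) ⊕ ((Fin nB ⊕ Fin nB) ⊕ (Fin m ⊕ Fin m)))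
      ((Fin nA ⊕ Fin nA) ⊕ ((Fin nB ⊕ Fin nB) ⊕ (Fin m ⊕ Fin m))) ℝ}
    (hW : IsQCM (fromBlocks (Omg nA) 0 0 (fromBlocks (Omg nB) 0 0 (Omg m))) W) :
    ∃ G, IsPureQCM (fromBlocks (Omg nA) 0 0 (Omg nB)) G ∧
      (W.submatrix eAB eAB - G).PosSemidef ∧ IM2 G ≤ IM3 W := by
  have hΩ := fromBlocks_diag_transpose (Omg_transpose nA) (Omg_transpose nB)
  have hΩ2 := fromBlocks_diag_mul_self (Omg_mul_self nA) (Omg_mul_self nB)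
  set σ := Equiv.sumAssoc (Fin nA ⊕ Fin nA) (Fin nB ⊕ Fin nB) (Fin m ⊕ Fin m)
  have hU := hW.submatrix σ
  rw [fromBlocks_sumAssoc] at hU
  set U := W.submatrix σ σ with hUdef
  have hUpd : U.PosDef := hU.posDef (fromBlocks_diag_transpose hΩ (Omg_transpose m))
    (fromBlocks_diag_mul_self hΩ2 (Omg_mul_self m))
  set P := W.submatrix eAB eAB
  set Q := U.toBlocks₁₂
  set R := U.toBlocks₂₂
  have hUb : U = fromBlocks P Q Qᵀ R := by
    conv_lhs => rw [← fromBlocks_toBlocks U]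
    congr 1
    ext i j
    exact hU.1.apply _ _
  have hR : R.PosDef := hUpd.submatrix Sum.inr_injective
  have hP : P.PosDef := by
    have : P = U.submatrix Sum.inl Sum.inl := by rw [hUb]; rfl
    rw [this]
    exact hUpd.submatrix Sum.inl_injective
  have hX : (P - Q * R⁻¹ * Qᵀ).PosDef := by
    have hH : (Q * R⁻¹ * Qᵀ).IsHermitian := by
      simpa using (hR.inv.posSemidef.mul_mul_conjTranspose_same Q).1
    refine .of_dotProduct_mulVec_pos (hP.1.sub hH) fun b hb => ?_
    rw [star_trivial, ← fromBlocks_quadratic_form P Q R hR b, ← hUb]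
    refine hUpd.dotProduct_mulVec_pos fun h0 => hb ?_
    ext i
    exact congrFun h0 (Sum.inl i)
  obtain ⟨G, hG, hGX, hpure⟩ := exists_isPureQCM_geomMean hΩ hΩ2 hX
  refine ⟨G, hpure, ?_, ?_⟩
  · refine posSemidef_sub_of_geomMean hX hG.1 hGX ?_ ?_
    · rw [sub_sub_cancel]
      simpa using hR.inv.posSemidef.mul_mul_conjTranspose_same Q
    · exact IsQCM.posSemidef_sub_schur (hUb ▸ hU) hΩ (Omg_transpose m) hP.1 hR hX
  · have hW' : W = (fromBlocks P Q Qᵀ R).submatrix σ.symm σ.symm := by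
      rw [← hUb, hUdef, submatrix_submatrix]
      simp
    rw [hW', IM3_submatrix_sumAssoc_symm _ _ _ hR.det_pos.ne'.isUnit]
    exact IM2_geomMean_le (by rw [Omg_transpose, mul_neg, Omg_mul_self, neg_neg])
      (by rw [Omg_transpose, mul_neg, Omg_mul_self, neg_neg]) hX hG hGX

/-- The Schur complement of a purified noise term `K` is positive semidefinite and bounded by a
multiple of the identity. -/
lemma Matrix.PosSemidef.schur_bounds {N : Type*} [Fintype N] [DecidableEq N] {K : Matrix N N ℝ}
    (hK : K.PosSemidef) {d : ℝ} (hd : d ≠ 0) :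
    (K - (d⁻¹ • K) * (1 + (d⁻¹ ^ 2) • K)⁻¹ * (d⁻¹ • K)).PosSemidef ∧
      (d ^ 2 • (1 : Matrix N N ℝ) -
        (K - (d⁻¹ • K) * (1 + (d⁻¹ ^ 2) • K)⁻¹ * (d⁻¹ • K))).PosSemidef := by
  have hR : (1 + (d⁻¹ ^ 2) • K).PosDef :=
    PosDef.one.add_posSemidef (hK.smul (sq_nonneg _))
  set R := 1 + (d⁻¹ ^ 2) • K with hRdef
  have hu : IsUnit R.det := hR.det_pos.ne'.isUnit
  have hRM : R * R⁻¹ = 1 := mul_nonsing_inv _ hu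
  have hMR : R⁻¹ * R = 1 := nonsing_inv_mul _ hu
  have hKR : K = d ^ 2 • (R - 1) := by
    rw [hRdef, add_sub_cancel_left, smul_smul, ← mul_pow, mul_inv_cancel₀ hd, one_pow, one_smul]
  have hD : K - (d⁻¹ • K) * R⁻¹ * (d⁻¹ • K) = d ^ 2 • (1 - R⁻¹) := by
    have h1 : (d⁻¹ • K) * R⁻¹ * (d⁻¹ • K) = d ^ 2 • ((R - 1) * R⁻¹ * (R - 1)) := by
      rw [hKR]
      simp only [Matrix.smul_mul, Matrix.mul_smul, smul_smul]
      congr 1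
      field_simp
    have h2 : (R - 1) * R⁻¹ * (R - 1) = R - 1 - (1 - R⁻¹) := by
      rw [sub_mul, hRM, one_mul, sub_mul, mul_sub R⁻¹, hMR, one_mul, mul_one]
    rw [h1, h2]
    nth_rw 1 [hKR]
    rw [← smul_sub, sub_sub_cancel]
  have hM := hR.inv.posSemidef
  rw [hD]
  refine ⟨?_, ?_⟩
  · have h : d ^ 2 • (1 - R⁻¹) = R⁻¹ * (K + d⁻¹ ^ 2 • (K * K)) * R⁻¹ᴴ := by
      have h1 : K + d⁻¹ ^ 2 • (K * K) = R * K := by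
        rw [hRdef, add_mul, one_mul, Matrix.smul_mul]
      rw [hM.1.eq, h1, ← mul_assoc, hMR, one_mul]
      nth_rw 1 [hKR]
      rw [Matrix.smul_mul, sub_mul, hRM, one_mul]
    rw [h]
    have hKK : (K * K).PosSemidef := by
      simpa only [hK.1.eq] using posSemidef_self_mul_conjTranspose K
    exact (hK.add (hKK.smul (sq_nonneg _))).mul_mul_conjTranspose_same _
  · rw [← smul_sub, sub_sub_cancel]
    exact hM.smul (sq_nonneg d)

/-- A pure QCM below `V` yields extensions of `V` whose conditional mutual information is
controlled by that of the pure QCM, up to a small perturbation of the local determinants. -/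
lemma exists_isQCM_IM3_le {V γ : Matrix ((Fin nA ⊕ Fin nA) ⊕ (Fin nB ⊕ Fin nB))
      ((Fin nA ⊕ Fin nA) ⊕ (Fin nB ⊕ Fin nB)) ℝ}
    (hγ : IsPureQCM (fromBlocks (Omg nA) 0 0 (Omg nB)) γ) (hγV : (V - γ).PosSemidef)
    {d : ℝ} (hd : d ≠ 0) :
    ∃ (m : ℕ) (W : Matrix ((Fin nA ⊕ Fin nA) ⊕ ((Fin nB ⊕ Fin nB) ⊕ (Fin m ⊕ Fin m)))
      ((Fin nA ⊕ Fin nA) ⊕ ((Fin nB ⊕ Fin nB) ⊕ (Fin m ⊕ Fin m))) ℝ),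
      IsQCM (fromBlocks (Omg nA) 0 0 (fromBlocks (Omg nB) 0 0 (Omg m))) W ∧
        W.submatrix eAB eAB = V ∧
        IM3 W ≤ 1 / 2 * Real.log
          ((γ.toBlocks₁₁ + d ^ 2 • 1).det * (γ.toBlocks₂₂ + d ^ 2 • 1).det / γ.det) := by
  set K := V - γ with hK
  have hΩ := fromBlocks_diag_transpose (Omg_transpose nA) (Omg_transpose nB)
  have hΩ2 := fromBlocks_diag_mul_self (Omg_mul_self nA) (Omg_mul_self nB)
  have hγpd := hγ.posDef hΩ hΩ2
  obtain ⟨e⟩ : Nonempty ((Fin (nA + nB) ⊕ Fin (nA + nB)) ≃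
      ((Fin nA ⊕ Fin nA) ⊕ (Fin nB ⊕ Fin nB))) :=
    ⟨Fintype.equivOfCardEq (by simp; ring)⟩
  set Q := (d⁻¹ • K).submatrix id e with hQ
  set R := (1 + (d⁻¹ ^ 2) • K).submatrix e e with hR
  have hQT : Qᵀ = (d⁻¹ • K).submatrix e id := by
    rw [hQ, transpose_submatrix, transpose_smul]
    congr 2
    simpa using hγV.1.eq
  have hRu : IsUnit R.det := by
    rw [hR, det_submatrix_equiv_self]
    exact (PosDef.one.add_posSemidef (hγV.smul (sq_nonneg _))).det_pos.ne'.isUnit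
  have hU : IsQCM (fromBlocks (fromBlocks (Omg nA) 0 0 (Omg nB)) 0 0 (Omg (nA + nB)))
      (fromBlocks V Q Qᵀ R) := by
    have h0 := (hγ.fromBlocks (isPureQCM_one (Ω := Omg (nA + nB)))).isQCM
      (fromBlocks_diag_transpose hΩ (Omg_transpose _))
      (fromBlocks_diag_mul_self hΩ2 (Omg_mul_self _))
    let E : Matrix ((Fin nA ⊕ Fin nA) ⊕ (Fin nB ⊕ Fin nB))
      ((Fin nA ⊕ Fin nA) ⊕ (Fin nB ⊕ Fin nB)) ℝ := 1
    have h1 := (hγV.conjTranspose_mul_mul_same (fromCols E (d⁻¹ • E))).submatrix (Sum.map id e)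
    convert h0.add_posSemidef h1 using 1
    rw [hQT, conjTranspose_fromCols_eq_fromRows_conjTranspose, fromRows_mul,
      fromRows_mul_fromCols]
    simp only [E, conjTranspose_one, one_mul, mul_one, conjTranspose_smul, star_trivial,
      Matrix.smul_mul, Matrix.mul_smul, smul_smul]
    ext (i | i) (j | j) <;>
      simp [hQ, hR, hK, Matrix.one_apply, e.injective.eq_iff, sq]
  have hS : V - Q * R⁻¹ * Qᵀ =
      γ + (K - (d⁻¹ • K) * (1 + (d⁻¹ ^ 2) • K)⁻¹ * (d⁻¹ • K)) := by
    rw [hQT, hQ, hR, inv_submatrix_equiv, submatrix_mul_equiv, submatrix_mul_equiv,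
      submatrix_id_id, hK]
    abel
  obtain ⟨hD, hD'⟩ := hγV.schur_bounds hd
  refine ⟨nA + nB, (fromBlocks V Q Qᵀ R).submatrix (Equiv.sumAssoc _ _ _).symm
    (Equiv.sumAssoc _ _ _).symm, ?_, ?_, ?_⟩
  · have h := hU.submatrix (Equiv.sumAssoc _ _ _).symm
    rw [← fromBlocks_sumAssoc, submatrix_submatrix] at h
    simpa using h
  · ext (i | i) (j | j) <;> rfl
  · rw [IM3_submatrix_sumAssoc_symm _ _ _ hRu, hS]
    set D := K - (d⁻¹ • K) * (1 + (d⁻¹ ^ 2) • K)⁻¹ * (d⁻¹ • K)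
    have hX : (γ + D).PosDef := hγpd.add_posSemidef hD
    have hdet : γ.det ≤ (γ + D).det := hγpd.det_le_det (by simpa using hD)
    have hA : (γ + D).toBlocks₁₁.det ≤ (γ.toBlocks₁₁ + d ^ 2 • 1).det := by
      refine PosDef.det_le_det (hX.submatrix Sum.inl_injective) ?_
      convert hD'.submatrix Sum.inl using 1
      ext i j
      simp [toBlocks₁₁, Matrix.one_apply]
    have hB : (γ + D).toBlocks₂₂.det ≤ (γ.toBlocks₂₂ + d ^ 2 • 1).det := by
      refine PosDef.det_le_det (hX.submatrix Sum.inr_injective) ?_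
      convert hD'.submatrix Sum.inr using 1
      ext i j
      simp [toBlocks₂₂, Matrix.one_apply]
    have hA0 : 0 < (γ + D).toBlocks₁₁.det :=
      PosDef.det_pos (hX.submatrix Sum.inl_injective)
    have hB0 : 0 < (γ + D).toBlocks₂₂.det :=
      PosDef.det_pos (hX.submatrix Sum.inr_injective)
    have hX0 := hX.det_pos
    have hγ0 := hγpd.det_pos
    have hA1 := hA0.le.trans hA
    have hB1 := hB0.le.trans hB
    unfold IM2
    gcongr

/-- Every pure QCM below `V` is approximated, in terms of mutual information, by extensions
of `V`. -/
lemma exists_isQCM_IM3_le_add {V γ : Matrix ((Fin nA ⊕ Fin nA) ⊕ (Fin nB ⊕ Fin nB))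
      ((Fin nA ⊕ Fin nA) ⊕ (Fin nB ⊕ Fin nB)) ℝ}
    (hγ : IsPureQCM (fromBlocks (Omg nA) 0 0 (Omg nB)) γ) (hγV : (V - γ).PosSemidef)
    {ε : ℝ} (hε : 0 < ε) :
    ∃ (m : ℕ) (W : Matrix ((Fin nA ⊕ Fin nA) ⊕ ((Fin nB ⊕ Fin nB) ⊕ (Fin m ⊕ Fin m)))
      ((Fin nA ⊕ Fin nA) ⊕ ((Fin nB ⊕ Fin nB) ⊕ (Fin m ⊕ Fin m))) ℝ),
      IsQCM (fromBlocks (Omg nA) 0 0 (fromBlocks (Omg nB) 0 0 (Omg m))) W ∧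
        W.submatrix eAB eAB = V ∧ IM3 W ≤ IM2 γ + ε := by
  have hγpd := hγ.posDef (fromBlocks_diag_transpose (Omg_transpose nA) (Omg_transpose nB))
    (fromBlocks_diag_mul_self (Omg_mul_self nA) (Omg_mul_self nB))
  have hA0 : 0 < γ.toBlocks₁₁.det := PosDef.det_pos (hγpd.submatrix Sum.inl_injective)
  have hB0 : 0 < γ.toBlocks₂₂.det := PosDef.det_pos (hγpd.submatrix Sum.inr_injective)
  let f : ℝ → ℝ := fun d => 1 / 2 * Real.log
    ((γ.toBlocks₁₁ + d ^ 2 • 1).det * (γ.toBlocks₂₂ + d ^ 2 • 1).det / γ.det)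
  have hf0 : f 0 = IM2 γ := by simp [f, IM2]
  have hf : ContinuousAt f 0 := by
    refine continuousAt_const.mul (ContinuousAt.log ?_ ?_)
    · refine Continuous.continuousAt (Continuous.div_const ?_ _)
      exact Continuous.mul (Continuous.matrix_det (by fun_prop))
        (Continuous.matrix_det (by fun_prop))
    · simpa using ⟨⟨hA0.ne', hB0.ne'⟩, hγpd.det_pos.ne'⟩
  have hlt := hf.eventually_lt_const (show f 0 < IM2 γ + ε by linarith)
  obtain ⟨d, hd, hd0⟩ :=
    ((hlt.filter_mono nhdsWithin_le_nhds).and (self_mem_nhdsWithin (s := {0}ᶜ))).exists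
  obtain ⟨m, W, hW, hWV, hle⟩ := exists_isQCM_IM3_le hγ hγV (show d ≠ 0 from hd0)
  exact ⟨m, W, hW, hWV, hle.trans hd.le⟩

end Main

/-- for every bipartite QCM, the Gaussian Rényi-2 squashed entanglement
equals the Gaussian Rényi-2 entanglement of formation. -/
theorem stmt17 {nA nB : ℕ}
    (V : Matrix ((Fin nA ⊕ Fin nA) ⊕ (Fin nB ⊕ Fin nB))
      ((Fin nA ⊕ Fin nA) ⊕ (Fin nB ⊕ Fin nB)) ℝ)
    (hV : IsQCM (fromBlocks (Omg nA) 0 0 (Omg nB)) V) :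
    Esq2 V = EF2 (fromBlocks (Omg nA) 0 0 (Omg nB)) V := by
  refine sInf_eq_sInf_of_approx ?_ ?_
  · rintro _ ⟨m, W, hW, rfl, rfl⟩
    obtain ⟨G, hG, hGV, hle⟩ := exists_isPureQCM_IM2_le_IM3 hW
    exact ⟨_, ⟨G, hG, hGV, rfl⟩, by linarith⟩
  · rintro _ ⟨γ, hγ, hγV, rfl⟩ ε hε
    obtain ⟨m, W, hW, hWV, hle⟩ := exists_isQCM_IM3_le_add hγ hγV hε
    exact ⟨_, ⟨m, W, hW, hWV, rfl⟩, by linarith⟩
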